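/- Consider N agents on a connected finite simple graph G on {1,…,N} with Laplacian matrix L and a constant λ_G > 0 such that vᵀ L v ≥ λ_G ‖v‖² for every v ∈ ℝ^N with 1ᵀv = 0. Let θ ∈ ℝⁿ be the unknown parameter and for each agent i let Cᵢ : ℝ → ℝ^{pᵢ×n} be continuously differentiable; set C'ᵢ(t) = Cᵢ(t)ᵀCᵢ(t), y'ᵢ(t) = C'ᵢ(t)θ, and C̄(t) = (1/N) Σᵢ C'ᵢ(t). Assume: (i) the stacked regressor C(t) = col(Cᵢ(t)) satisfies PE(α,T) for some α,T>0, i.e. ∫_t^{t+T} Σᵢ C'ᵢ(τ) dτ − α·Iₙ is positive semidefinite for all t ≥ 0; (ii) ‖C̄(t)‖ ≤ β for all t ≥ 0, and the stacked deviation matrix D(t) ∈ ℝ^{Nn×n}, whose i-th n×n block is d/dt C'ᵢ(t) − (1/N) Σⱼ d/dt C'ⱼ(t), satisfies ‖D(t)‖ ≤ γ for all t ≥ 0 (operator norms); (iii) the consensus gain satisfies k > 2 n N² β γ T² / (λ_G α²). Suppose Xᵢ : ℝ → ℝ^{n×n}, xᵢ : ℝ → ℝⁿ, θ̂ᵢ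 : ℝ → ℝⁿ are differentiable on [0,∞) and satisfy for all t ≥ 0: Ẋᵢ(t) = k Σ_{j∈N(i)} (Ĉᵢ(t) − Ĉⱼ(t)), ẋᵢ(t) = k Σ_{j∈N(i)} (ŷᵢ(t) − ŷⱼ(t)), where Ĉᵢ(t) = C'ᵢ(t) − Xᵢ(t), ŷᵢ(t) = y'ᵢ(t) − xᵢ(t), together with the local gradient estimator θ̂ᵢ'(t) = Γᵢ Ĉᵢ(t)ᵀ (ŷᵢ(t) − Ĉᵢ(t) θ̂ᵢ(t)) with Γᵢ symmetric positive definite, and Xᵢ(0) = 0, xᵢ(0) = 0. Then the estimation error of each agent is globally uniformly exponentially stable: there exist κ, λ > 0 such that for every agent i and all t ≥ t₀ ≥ 0, ‖θ̂ᵢ(t) − θ‖ ≤ κ e^{−λ(t−t₀)} ‖θ̂ᵢ(t₀) − θ‖. -/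

import Mathlib

open Matrix MeasureTheory

/-- The Euclidean norm of a finitely-indexed real vector. -/
noncomputable def euclNorm {ι : Type*} [Fintype ι] (v : ι → ℝ) : ℝ :=
  Real.sqrt (∑ i, v i ^ 2)

section GradientFlow

open Set Filter Topology

/-- A nonnegative nonincreasing function that contracts by a factor `ρ` over every window of length
`T` decays exponentially. -/
lemma exp_decay_of_window_contraction {W : ℝ → ℝ} {T ρ : ℝ} (hT : 0 < T) (hρ : 0 < ρ)
    (hρ1 : ρ < 1) (hanti : AntitoneOn W (Ici 0)) (hnonneg : ∀ t, 0 ≤ W t)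
    (hcontr : ∀ t, 0 ≤ t → W (t + T) ≤ ρ * W t) {t₀ t : ℝ} (ht₀ : 0 ≤ t₀) (ht : t₀ ≤ t) :
    W t ≤ ρ⁻¹ * Real.exp (-(-Real.log ρ / T) * (t - t₀)) * W t₀ := by
  have hiter : ∀ m : ℕ, W (t₀ + m * T) ≤ ρ ^ m * W t₀ := by
    intro m
    induction m with
    | zero => simp
    | succ m ih =>
      have h := hcontr (t₀ + m * T) (by positivity)
      have e : t₀ + ((m + 1 : ℕ) : ℝ) * T = t₀ + m * T + T := by push_cast; ring
      rw [e, pow_succ']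
      calc _ ≤ ρ * W (t₀ + m * T) := h
        _ ≤ ρ * (ρ ^ m * W t₀) := by gcongr
        _ = _ := by ring
  set m := ⌊(t - t₀) / T⌋₊ with hm
  have hle : (m : ℝ) ≤ (t - t₀) / T := Nat.floor_le (div_nonneg (by linarith) hT.le)
  have hlt : (t - t₀) / T < m + 1 := Nat.lt_floor_add_one _
  have hle' : (m : ℝ) * T ≤ t - t₀ := (le_div_iff₀ hT).1 hle
  have h1 : W t ≤ W (t₀ + m * T) :=
    hanti (show (0 : ℝ) ≤ t₀ + m * T by positivity) (show (0 : ℝ) ≤ t by linarith) (by linarith)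
  have hlog : Real.log ρ < 0 := Real.log_neg hρ hρ1
  have h2 : ρ ^ m ≤ ρ⁻¹ * Real.exp (-(-Real.log ρ / T) * (t - t₀)) := by
    have e1 : ρ ^ m = Real.exp (Real.log ρ * m) := by
      rw [← Real.rpow_natCast, Real.rpow_def_of_pos hρ]
    have e2 : ρ⁻¹ = Real.exp (-Real.log ρ) := by rw [Real.exp_neg, Real.exp_log hρ]
    rw [e1, e2, ← Real.exp_add]
    apply Real.exp_le_exp.2
    have e3 : -(-Real.log ρ / T) * (t - t₀) = Real.log ρ * ((t - t₀) / T) := by ring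
    rw [e3]
    nlinarith
  calc W t ≤ ρ ^ m * W t₀ := h1.trans (hiter m)
    _ ≤ _ := mul_le_mul_of_nonneg_right h2 (hnonneg _)

variable {E : Type*} [NormedAddCommGroup E] [InnerProductSpace ℝ E] [CompleteSpace E]

/-- Cauchy–Schwarz for the integral of a real function over an interval. -/
lemma sq_integral_le_mul_integral_sq {f : ℝ → ℝ} {t T : ℝ} (hT : 0 < T)
    (hf : ContinuousOn f (Icc t (t + T))) :
    (∫ s in t..t + T, f s) ^ 2 ≤ T * ∫ s in t..t + T, f s ^ 2 := by
  have hle : t ≤ t + T := by linarith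
  set J := ∫ s in t..t + T, f s with hJ
  have i1 : IntervalIntegrable f volume t (t + T) := hf.intervalIntegrable_of_Icc hle
  have i2 : IntervalIntegrable (fun s => f s ^ 2) volume t (t + T) :=
    (hf.pow 2).intervalIntegrable_of_Icc hle
  have h : ∫ s in t..t + T, (2 * (J / T) * f s - (J / T) ^ 2) ≤ ∫ s in t..t + T, f s ^ 2 := by
    apply intervalIntegral.integral_mono_on hle ((i1.const_mul _).sub (by simp)) i2
    intro s _
    nlinarith [sq_nonneg (f s - J / T)]
  rw [intervalIntegral.integral_sub (i1.const_mul _) (by simp),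
    intervalIntegral.integral_const_mul, ← hJ] at h
  simp only [intervalIntegral.integral_const, add_sub_cancel_left, smul_eq_mul] at h
  have e : T * (2 * (J / T) * J - T * (J / T) ^ 2) = J ^ 2 := by field_simp; ring
  calc J ^ 2 = T * (2 * (J / T) * J - T * (J / T) ^ 2) := e.symm
    _ ≤ _ := by gcongr

/-- A gradient flow `ż = -A†Az` with bounded, persistently exciting regressor `A` is globally
uniformly exponentially stable. -/
lemma gradient_flow_exp_decay {A : ℝ → E →L[ℝ] E} {z : ℝ → E} {a b T : ℝ} (ha : 0 < a)
    (hT : 0 < T) (hA : ContinuousOn A (Ici 0)) (hb : ∀ t, 0 ≤ t → ‖A t‖ ≤ b)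
    (hPE : ∀ t, 0 ≤ t → ∀ v : E, a * ‖v‖ ≤ ∫ s in t..t + T, ‖A s v‖)
    (hz : ∀ t, 0 ≤ t →
      HasDerivWithinAt z (-(ContinuousLinearMap.adjoint (A t) (A t (z t)))) (Ici 0) t) :
    ∃ κ > (0 : ℝ), ∃ μ > (0 : ℝ), ∀ t₀ t : ℝ, 0 ≤ t₀ → t₀ ≤ t →
      ‖z t‖ ≤ κ * Real.exp (-μ * (t - t₀)) * ‖z t₀‖ := by
  have hb0 : 0 ≤ b := (norm_nonneg _).trans (hb 0 le_rfl)
  have hzc : ContinuousOn z (Ici 0) := fun t ht => (hz t ht).continuousWithinAt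
  have hAzc : ContinuousOn (fun s => A s (z s)) (Ici 0) := hA.clm_apply hzc
  have hadj : ContinuousOn (fun s => ContinuousLinearMap.adjoint (A s) (A s (z s))) (Ici 0) :=
    ((ContinuousLinearMap.adjoint (𝕜 := ℝ) (E := E) (F := E)).continuous.comp_continuousOn
      hA).clm_apply hAzc
  have hW : ∀ t, 0 ≤ t →
      HasDerivWithinAt (fun s => ‖z s‖ ^ 2) (-2 * ‖A t (z t)‖ ^ 2) (Ici 0) t := by
    intro t ht
    convert (hz t ht).norm_sq using 1
    rw [inner_neg_right, ContinuousLinearMap.adjoint_inner_right, real_inner_self_eq_norm_sq]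
    ring
  have hanti : AntitoneOn (fun s => ‖z s‖ ^ 2) (Ici 0) := by
    refine antitoneOn_of_hasDerivWithinAt_nonpos (convex_Ici 0) (hzc.norm.pow 2)
      (fun t ht => (hW t (interior_subset ht)).mono interior_subset) ?_
    intro t _
    nlinarith [sq_nonneg ‖A t (z t)‖]
  set c := 1 + b ^ 2 * T + a * T with hc
  have hcpos : 0 < c := by positivity
  set q := 2 * a ^ 2 / (T * c ^ 2) with hq
  have hqpos : 0 < q := by positivity
  have hcontr : ∀ t, 0 ≤ t → ‖z (t + T)‖ ^ 2 ≤ (1 - q) * ‖z t‖ ^ 2 := by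
    intro t ht
    have hle : t ≤ t + T := by linarith
    have hsub : Icc t (t + T) ⊆ Ici 0 := fun s hs => ht.trans hs.1
    have hAzi : ContinuousOn (fun s => ‖A s (z s)‖) (Icc t (t + T)) := (hAzc.mono hsub).norm
    set J := ∫ s in t..t + T, ‖A s (z s)‖ with hJ
    have hdrop : ‖z (t + T)‖ ^ 2 - ‖z t‖ ^ 2 = -2 * ∫ s in t..t + T, ‖A s (z s)‖ ^ 2 := by
      rw [← intervalIntegral.integral_const_mul]
      symm
      refine intervalIntegral.integral_eq_sub_of_hasDeriv_right_of_le hle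
        ((hzc.mono hsub).norm.pow 2) (fun s hs => ?_) ?_
      · exact (hW s (ht.trans hs.1.le)).mono fun r hr => (ht.trans hs.1.le).trans (le_of_lt hr)
      · exact ((hAzi.pow 2).const_mul _).intervalIntegrable_of_Icc hle
    have hCS : J ^ 2 ≤ T * ∫ s in t..t + T, ‖A s (z s)‖ ^ 2 :=
      sq_integral_le_mul_integral_sq hT hAzi
    have hdev : ∀ s ∈ Icc t (t + T), ‖z t - z s‖ ≤ b * J := by
      intro s hs
      have hsub' : Icc t s ⊆ Icc t (t + T) := Icc_subset_Icc_right hs.2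
      have h1 : ∫ r in t..s, -(ContinuousLinearMap.adjoint (A r) (A r (z r))) = z s - z t := by
        refine intervalIntegral.integral_eq_sub_of_hasDeriv_right_of_le hs.1
          (hzc.mono (hsub'.trans hsub)) (fun r hr => ?_) ?_
        · exact (hz r (ht.trans hr.1.le)).mono fun r' hr' => (ht.trans hr.1.le).trans (le_of_lt hr')
        · exact (hadj.mono (hsub'.trans hsub)).neg.intervalIntegrable_of_Icc hs.1
      rw [norm_sub_rev, ← h1]
      have i1 : IntervalIntegrable (fun r => ‖A r (z r)‖) volume t s :=
        (hAzi.mono hsub').intervalIntegrable_of_Icc hs.1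
      calc ‖∫ r in t..s, -(ContinuousLinearMap.adjoint (A r) (A r (z r)))‖
          ≤ ∫ r in t..s, b * ‖A r (z r)‖ := by
            refine intervalIntegral.norm_integral_le_of_norm_le hs.1 ?_ (i1.const_mul _)
            refine Eventually.of_forall fun r hr => ?_
            rw [norm_neg]
            refine (ContinuousLinearMap.le_opNorm _ _).trans ?_
            rw [LinearIsometryEquiv.norm_map]
            exact mul_le_mul_of_nonneg_right (hb r (ht.trans hr.1.le)) (norm_nonneg _)
        _ = b * ∫ r in t..s, ‖A r (z r)‖ := intervalIntegral.integral_const_mul _ _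
        _ ≤ b * J := by
            refine mul_le_mul_of_nonneg_left ?_ hb0
            exact intervalIntegral.integral_mono_interval le_rfl hs.1 hs.2
              (Eventually.of_forall fun _ => norm_nonneg _) (hAzi.intervalIntegrable_of_Icc hle)
    have hJ0 : 0 ≤ J := intervalIntegral.integral_nonneg hle fun _ _ => norm_nonneg _
    have hlow : a * ‖z t‖ ≤ c * J := by
      have i1 : IntervalIntegrable (fun r => ‖A r (z r)‖) volume t (t + T) :=
        hAzi.intervalIntegrable_of_Icc hle
      have hvc : ContinuousOn (fun s => ‖A s (z t)‖) (Icc t (t + T)) :=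
        ((hA.mono hsub).clm_apply continuousOn_const).norm
      have : ∫ s in t..t + T, ‖A s (z t)‖ ≤ ∫ s in t..t + T, (‖A s (z s)‖ + b * (b * J)) := by
        refine intervalIntegral.integral_mono_on hle (hvc.intervalIntegrable_of_Icc hle)
          (i1.add (by simp)) fun s hs => ?_
        have e : A s (z t) = A s (z s) + A s (z t - z s) := by rw [map_sub]; abel
        rw [e]
        refine (norm_add_le _ _).trans (add_le_add le_rfl ?_)
        refine (ContinuousLinearMap.le_opNorm _ _).trans ?_
        exact mul_le_mul (hb s (hsub hs)) (hdev s hs) (norm_nonneg _) hb0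
      rw [intervalIntegral.integral_add i1 (by simp), intervalIntegral.integral_const,
        add_sub_cancel_left, smul_eq_mul, ← hJ] at this
      have h3 := hPE t ht (z t)
      have : 0 ≤ a * T * J := by positivity
      rw [hc]
      nlinarith
    have h5 : a ^ 2 * ‖z t‖ ^ 2 ≤ c ^ 2 * J ^ 2 := by
      rw [← mul_pow, ← mul_pow]
      exact pow_le_pow_left₀ (by positivity) hlow 2
    have h6 : q * ‖z t‖ ^ 2 ≤ 2 * ∫ s in t..t + T, ‖A s (z s)‖ ^ 2 := by
      rw [hq, div_mul_eq_mul_div, div_le_iff₀ (by positivity)]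
      nlinarith [sq_nonneg c]
    linarith
  set ρ := max (1 - q) (1 / 2) with hρ
  have hρ0 : 0 < ρ := lt_of_lt_of_le (by norm_num) (le_max_right _ _)
  have hρ1 : ρ < 1 := max_lt (by linarith) (by norm_num)
  refine ⟨√(ρ⁻¹), by positivity, -Real.log ρ / T / 2, ?_, ?_⟩
  · have := Real.log_neg hρ0 hρ1
    have : 0 < -Real.log ρ := by linarith
    positivity
  intro t₀ t ht₀ ht
  have h := exp_decay_of_window_contraction hT hρ0 hρ1 hanti (fun _ => by positivity)
    (fun s hs => (hcontr s hs).trans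
      (mul_le_mul_of_nonneg_right (le_max_left _ _) (by positivity))) ht₀ ht
  refine (pow_le_pow_iff_left₀ (norm_nonneg _) (by positivity) two_ne_zero).1 ?_
  rw [mul_pow, mul_pow, Real.sq_sqrt (by positivity), ← Real.exp_nat_mul]
  have e : ((2 : ℕ) : ℝ) * (-(-Real.log ρ / T / 2) * (t - t₀)) = -(-Real.log ρ / T) * (t - t₀) := by
    push_cast; ring
  rwa [e]

/-- A gradient flow `ż = -RR†A†Az` with invertible preconditioner `RR†` and bounded, persistently
exciting regressor `A` is globally uniformly exponentially stable. -/
lemma preconditioned_gradient_flow_exp_decay {A : ℝ → E →L[ℝ] E} {R S : E →L[ℝ] E} {z : ℝ → E}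
    {a b T : ℝ} (hRS : R * S = 1) (hSR : S * R = 1) (ha : 0 < a)
    (hT : 0 < T) (hA : ContinuousOn A (Ici 0)) (hb : ∀ t, 0 ≤ t → ‖A t‖ ≤ b)
    (hPE : ∀ t, 0 ≤ t → ∀ v : E, a * ‖v‖ ≤ ∫ s in t..t + T, ‖A s v‖)
    (hz : ∀ t, 0 ≤ t → HasDerivWithinAt z
      (-(R (ContinuousLinearMap.adjoint R (ContinuousLinearMap.adjoint (A t) (A t (z t))))))
      (Ici 0) t) :
    ∃ κ > (0 : ℝ), ∃ μ > (0 : ℝ), ∀ t₀ t : ℝ, 0 ≤ t₀ → t₀ ≤ t →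
      ‖z t‖ ≤ κ * Real.exp (-μ * (t - t₀)) * ‖z t₀‖ := by
  have hRS' : ∀ v, R (S v) = v := fun v => by simpa using congrArg (fun f => f v) hRS
  have hSR' : ∀ v, S (R v) = v := fun v => by simpa using congrArg (fun f => f v) hSR
  obtain ⟨κ, hκ, μ, hμ, h⟩ := gradient_flow_exp_decay (A := fun t => (A t).comp R)
    (z := fun t => S (z t)) (a := a / (‖S‖ + 1)) (b := b * ‖R‖) (by positivity) hT
    (hA.clm_comp continuousOn_const)
    (fun t ht => (ContinuousLinearMap.opNorm_comp_le _ _).trans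
      (mul_le_mul_of_nonneg_right (hb t ht) (norm_nonneg _)))
    (by
      intro t ht v
      refine le_trans ?_ (hPE t ht (R v))
      have : ‖v‖ ≤ (‖S‖ + 1) * ‖R v‖ := by
        calc ‖v‖ = ‖S (R v)‖ := by rw [hSR']
          _ ≤ ‖S‖ * ‖R v‖ := S.le_opNorm _
          _ ≤ _ := by gcongr; linarith
      rw [div_mul_eq_mul_div, div_le_iff₀ (by positivity)]
      nlinarith)
    (by
      intro t ht
      have := S.hasFDerivAt.comp_hasDerivWithinAt t (hz t ht)
      refine this.congr_deriv ?_
      simp [ContinuousLinearMap.adjoint_comp, hSR', hRS'])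
  refine ⟨(‖R‖ + 1) * κ * (‖S‖ + 1), by positivity, μ, hμ, fun t₀ t ht₀ ht => ?_⟩
  calc ‖z t‖ = ‖R (S (z t))‖ := by rw [hRS']
    _ ≤ ‖R‖ * ‖S (z t)‖ := R.le_opNorm _
    _ ≤ (‖R‖ + 1) * (κ * Real.exp (-μ * (t - t₀)) * ‖S (z t₀)‖) :=
      mul_le_mul (by linarith) (h t₀ t ht₀ ht) (norm_nonneg _) (by positivity)
    _ ≤ (‖R‖ + 1) * (κ * Real.exp (-μ * (t - t₀)) * ((‖S‖ + 1) * ‖z t₀‖)) := by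
      gcongr
      exact (S.le_opNorm _).trans (by gcongr; linarith)
    _ = _ := by ring

end GradientFlow

section Consensus

open Set

/-- Grönwall comparison: `Ṡ ≤ -μS + p` implies exponential decay of `S` up to `p / μ`. -/
lemma le_exp_decay_add_of_deriv_le {S S' : ℝ → ℝ} {μ p : ℝ} (hμ : 0 < μ) (hp : 0 ≤ p)
    (hS : ∀ t, 0 ≤ t → HasDerivWithinAt S (S' t) (Ici 0) t)
    (hle : ∀ t, 0 ≤ t → S' t ≤ -μ * S t + p) {t : ℝ} (ht : 0 ≤ t) :
    S t ≤ Real.exp (-μ * t) * S 0 + p / μ := by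
  have hd : ∀ t, 0 ≤ t → HasDerivWithinAt (fun s => Real.exp (μ * s) * (S s - p / μ))
      (Real.exp (μ * t) * (μ * 1) * (S t - p / μ) + Real.exp (μ * t) * S' t) (Ici 0) t := by
    intro t ht
    exact ((hasDerivAt_id t).const_mul μ).exp.hasDerivWithinAt.mul ((hS t ht).sub_const _)
  have hanti : AntitoneOn (fun s => Real.exp (μ * s) * (S s - p / μ)) (Ici 0) := by
    refine antitoneOn_of_hasDerivWithinAt_nonpos (convex_Ici 0)
      (fun t ht => (hd t ht).continuousWithinAt)
      (fun t ht => (hd t (interior_subset ht)).mono interior_subset) ?_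
    intro t ht
    have h := hle t (interior_subset ht)
    have e : μ * (p / μ) = p := by field_simp
    have : Real.exp (μ * t) * (μ * 1) * (S t - p / μ) + Real.exp (μ * t) * S' t
        = Real.exp (μ * t) * (S' t - (-μ * S t + p)) := by
      linear_combination (-Real.exp (μ * t)) * e
    rw [this]
    exact mul_nonpos_of_nonneg_of_nonpos (Real.exp_pos _).le (by linarith)
  have h := hanti (mem_Ici.2 (le_refl (0 : ℝ))) ht ht
  simp only [mul_zero, Real.exp_zero, one_mul] at h
  have e : Real.exp (-μ * t) * Real.exp (μ * t) = 1 := by rw [← Real.exp_add]; simp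
  have h2 := mul_le_mul_of_nonneg_left h (Real.exp_pos (-μ * t)).le
  rw [← mul_assoc, e, one_mul] at h2
  have : 0 ≤ Real.exp (-μ * t) * (p / μ) := by positivity
  nlinarith

variable {V κ : Type*} [Fintype V] [Fintype κ] (G : SimpleGraph V) [DecidableRel G.Adj]

lemma lapMatrix_mulVec_eq_sum_neighborFinset_sub [DecidableEq V] (g : V → ℝ) (i : V) :
    (G.lapMatrix ℝ *ᵥ g) i = ∑ j ∈ G.neighborFinset i, (g i - g j) := by
  rw [SimpleGraph.lapMatrix_mulVec_apply, Finset.sum_sub_distrib, Finset.sum_const,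
    SimpleGraph.card_neighborFinset_eq_degree, nsmul_eq_mul]

lemma sum_sum_neighborFinset_sub (g : V → ℝ) :
    ∑ i, ∑ j ∈ G.neighborFinset i, (g i - g j) = 0 := by
  have e : ∀ i, ∑ j ∈ G.neighborFinset i, (g i - g j)
      = ∑ j, if G.Adj i j then g i - g j else 0 := by
    intro i
    rw [← Finset.sum_filter, SimpleGraph.neighborFinset_eq_filter]
  have h : ∑ i, ∑ j, (if G.Adj i j then g i - g j else 0)
      = -∑ i, ∑ j, (if G.Adj i j then g i - g j else 0) := by
    conv_lhs => rw [Finset.sum_comm]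
    rw [← Finset.sum_neg_distrib]
    refine Finset.sum_congr rfl fun i _ => ?_
    rw [← Finset.sum_neg_distrib]
    refine Finset.sum_congr rfl fun j _ => ?_
    simp only [G.adj_comm j i]
    split_ifs <;> ring
  simp only [e]
  linarith

/-- Diffusive coupling preserves the sum over the agents. -/
lemma sum_eq_sum_zero_of_diffusive {y g : V → ℝ → ℝ} {k : ℝ}
    (hy : ∀ i, ∀ t, 0 ≤ t → HasDerivWithinAt (y i)
      (k * ∑ j ∈ G.neighborFinset i, (g i t - g j t)) (Ici 0) t) {t : ℝ} (ht : 0 ≤ t) :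
    ∑ i, y i t = ∑ i, y i 0 := by
  have hd : ∀ s, 0 ≤ s → HasDerivWithinAt (fun r => ∑ i, y i r) 0 (Ici 0) s := by
    intro s hs
    have := HasDerivWithinAt.fun_sum (u := Finset.univ) fun i _ => hy i s hs
    rwa [← Finset.mul_sum, sum_sum_neighborFinset_sub G (fun i => g i s), mul_zero] at this
  refine constant_of_has_deriv_right_zero (f := fun r => ∑ i, y i r) (a := 0) (b := t)
    (fun s hs => ((hd s hs.1).continuousWithinAt).mono fun r hr => hr.1)
    (fun s hs => (hd s hs.1).mono fun r hr => hs.1.trans hr) t ⟨ht, le_rfl⟩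

/-- Dynamic average consensus: the disagreement `w`, driven by `d` with `∑ d² ≤ p`, decays
exponentially up to `p / (kλ)²`. -/
lemma consensus_disagreement_le [DecidableEq V] {lamG k p : ℝ} (hlamG : 0 < lamG) (hk : 0 < k) (hp : 0 ≤ p)
    (hLap : ∀ v : V → ℝ, (∑ i, v i) = 0 →
      lamG * (∑ i, v i ^ 2) ≤ v ⬝ᵥ ((G.lapMatrix ℝ).mulVec v))
    {w d : V → κ → ℝ → ℝ}
    (hw : ∀ i a t, 0 ≤ t → HasDerivWithinAt (w i a)
      (d i a t - k * ∑ j ∈ G.neighborFinset i, (w i a t - w j a t)) (Ici 0) t)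
    (hsum : ∀ a t, 0 ≤ t → ∑ i, w i a t = 0)
    (hd : ∀ t, 0 ≤ t → ∑ i, ∑ a, d i a t ^ 2 ≤ p) {t : ℝ} (ht : 0 ≤ t) :
    ∑ i, ∑ a, w i a t ^ 2 ≤
      Real.exp (-(k * lamG) * t) * ∑ i, ∑ a, w i a 0 ^ 2 + p / (k * lamG) ^ 2 := by
  have hμ : 0 < k * lamG := by positivity
  set μ := k * lamG with hμdef
  have hS : ∀ t, 0 ≤ t → HasDerivWithinAt (fun s => ∑ i, ∑ a, w i a s ^ 2)
      (∑ i, ∑ a, 2 * w i a t *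
        (d i a t - k * ∑ j ∈ G.neighborFinset i, (w i a t - w j a t))) (Ici 0) t := by
    intro t ht
    refine HasDerivWithinAt.fun_sum fun i _ => HasDerivWithinAt.fun_sum fun a _ => ?_
    exact ((hw i a t ht).fun_pow 2).congr_deriv (by push_cast; ring)
  have h := le_exp_decay_add_of_deriv_le hμ (div_nonneg hp hμ.le) hS ?_ ht
  · rwa [div_div, ← sq] at h
  intro t ht
  have hquad : lamG * ∑ i, ∑ a, w i a t ^ 2 ≤
      ∑ i, ∑ a, w i a t * ∑ j ∈ G.neighborFinset i, (w i a t - w j a t) := by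
    rw [Finset.sum_comm, Finset.mul_sum, Finset.sum_comm (s := Finset.univ (α := V))]
    refine Finset.sum_le_sum fun a _ => ?_
    have := hLap (fun i => w i a t) (hsum a t ht)
    simpa only [dotProduct, lapMatrix_mulVec_eq_sum_neighborFinset_sub] using this
  have hforce : ∑ i, ∑ a, 2 * w i a t * d i a t ≤
      μ * ∑ i, ∑ a, w i a t ^ 2 + (∑ i, ∑ a, d i a t ^ 2) / μ := by
    rw [Finset.mul_sum, Finset.sum_div, ← Finset.sum_add_distrib]
    refine Finset.sum_le_sum fun i _ => ?_
    rw [Finset.mul_sum, Finset.sum_div, ← Finset.sum_add_distrib]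
    refine Finset.sum_le_sum fun a _ => ?_
    have e : μ * w i a t ^ 2 + d i a t ^ 2 / μ - 2 * w i a t * d i a t
        = (μ * w i a t - d i a t) ^ 2 / μ := by field_simp; ring
    have : 0 ≤ (μ * w i a t - d i a t) ^ 2 / μ := by positivity
    linarith
  have hsplit : ∑ i, ∑ a, 2 * w i a t *
        (d i a t - k * ∑ j ∈ G.neighborFinset i, (w i a t - w j a t))
      = ∑ i, ∑ a, 2 * w i a t * d i a t
        - 2 * k * ∑ i, ∑ a, w i a t * ∑ j ∈ G.neighborFinset i, (w i a t - w j a t) := by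
    simp only [Finset.mul_sum (s := Finset.univ), ← Finset.sum_sub_distrib]
    refine Finset.sum_congr rfl fun i _ => Finset.sum_congr rfl fun a _ => by ring
  rw [hsplit]
  have h1 : (∑ i, ∑ a, d i a t ^ 2) / μ ≤ p / μ := div_le_div_of_nonneg_right (hd t ht) hμ.le
  have h2 := mul_le_mul_of_nonneg_left hquad (show 0 ≤ 2 * k by positivity)
  have e : 2 * k * (lamG * ∑ i, ∑ a, w i a t ^ 2) = 2 * (μ * ∑ i, ∑ a, w i a t ^ 2) := by
    rw [hμdef]; ring
  rw [e] at h2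
  linarith

end Consensus

section Matrices

lemma euclNorm_eq_norm_toLp {ι : Type*} [Fintype ι] (v : ι → ℝ) :
    euclNorm v = ‖WithLp.toLp 2 v‖ := by
  rw [EuclideanSpace.norm_eq]
  simp [euclNorm]

lemma euclNorm_sq {ι : Type*} [Fintype ι] (v : ι → ℝ) : euclNorm v ^ 2 = ∑ i, v i ^ 2 :=
  Real.sq_sqrt (Finset.sum_nonneg fun _ _ => sq_nonneg _)

lemma euclNorm_nonneg {ι : Type*} [Fintype ι] (v : ι → ℝ) : 0 ≤ euclNorm v := Real.sqrt_nonneg _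

/-- A positive definite real matrix factors as `R * Rᵀ` with `R` invertible. -/
lemma Matrix.PosDef.exists_eq_mul_transpose {n : Type*} [Fintype n] [DecidableEq n]
    {Γ : Matrix n n ℝ} (hΓ : Γ.PosDef) :
    ∃ R S : Matrix n n ℝ, R * S = 1 ∧ S * R = 1 ∧ Γ = R * star R := by
  open scoped MatrixOrder in
  obtain ⟨B, rfl⟩ := CStarAlgebra.nonneg_iff_eq_star_mul_self.mp hΓ.posSemidef.nonneg
  have hdet : IsUnit (star B * B).det := (Matrix.isUnit_iff_isUnit_det _).1 hΓ.isUnit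
  rw [Matrix.det_mul] at hdet
  have hB : IsUnit (star B).det := isUnit_of_mul_isUnit_left hdet
  exact ⟨star B, (star B)⁻¹, Matrix.mul_nonsing_inv _ hB, Matrix.nonsing_inv_mul _ hB, by simp⟩

lemma continuousOn_toEuclideanCLM {n : Type*} [Fintype n] [DecidableEq n] {s : Set ℝ}
    {M : ℝ → Matrix n n ℝ} (hM : ∀ a b, ContinuousOn (fun t => M t a b) s) :
    ContinuousOn (fun t => Matrix.toEuclideanCLM (𝕜 := ℝ) (M t)) s := by
  have hlin : Continuous
      ((Matrix.toEuclideanCLM (n := n) (𝕜 := ℝ)).toAlgEquiv.toLinearMap) :=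
    LinearMap.continuous_of_finiteDimensional _
  exact hlin.comp_continuousOn (continuousOn_pi.2 fun a => continuousOn_pi.2 fun b => hM a b)

end Matrices

section Estimator

open Set Filter Topology

variable {n : Type*} [Fintype n]

lemma continuousOn_euclNorm_mulVec {s : Set ℝ} {M : ℝ → Matrix n n ℝ}
    (hM : ∀ a b, ContinuousOn (fun t => M t a b) s) (v : n → ℝ) :
    ContinuousOn (fun t => euclNorm (M t *ᵥ v)) s := by
  refine Real.continuous_sqrt.comp_continuousOn ?_
  refine continuousOn_finsetSum _ fun a _ => ContinuousOn.pow ?_ 2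
  exact continuousOn_finsetSum _ fun b _ => (hM a b).mul continuousOn_const

lemma dotProduct_le_euclNorm_mul (v w : n → ℝ) : v ⬝ᵥ w ≤ euclNorm v * euclNorm w :=
  Real.sum_mul_le_sqrt_mul_sqrt _ _ _

/-- The Euclidean norm of a matrix-vector product is controlled by the sum of the squared
entries. -/
lemma sum_mulVec_sq_le (M : Matrix n n ℝ) (v : n → ℝ) :
    ∑ a, (M *ᵥ v) a ^ 2 ≤ (∑ a, ∑ b, M a b ^ 2) * euclNorm v ^ 2 := by
  rw [euclNorm_sq, Finset.sum_mul]
  exact Finset.sum_le_sum fun a _ => Finset.sum_mul_sq_le_sq_mul_sq _ _ _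

/-- Persistency of excitation of `M` in quadratic form implies excitation in norm. -/
lemma mul_euclNorm_le_integral_of_posSemidef [DecidableEq n] {M : ℝ → Matrix n n ℝ} {t T α : ℝ}
    (hT : 0 ≤ T) (hM : ∀ a b, Continuous fun t => M t a b)
    (hPE : Matrix.PosSemidef ((Matrix.of fun a b => ∫ τ in t..(t + T), M τ a b) -
      α • (1 : Matrix n n ℝ))) (v : n → ℝ) :
    α * euclNorm v ≤ ∫ τ in t..t + T, euclNorm (M τ *ᵥ v) := by
  have hle : t ≤ t + T := by linarith
  have hcont : Continuous fun τ => euclNorm (M τ *ᵥ v) :=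
    continuousOn_univ.1 (continuousOn_euclNorm_mulVec (fun a b => (hM a b).continuousOn) v)
  have hint : v ⬝ᵥ ((Matrix.of fun a b => ∫ τ in t..(t + T), M τ a b) *ᵥ v)
      = ∫ τ in t..t + T, v ⬝ᵥ (M τ *ᵥ v) := by
    have i1 : ∀ a b, IntervalIntegrable (fun τ => M τ a b * v b) volume t (t + T) := fun a b =>
      ((hM a b).mul continuous_const).intervalIntegrable _ _
    have i2 : ∀ a, IntervalIntegrable (fun τ => v a * ∑ b, M τ a b * v b) volume t (t + T) :=
      fun a => Continuous.intervalIntegrable (continuous_const.mul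
        (continuous_finsetSum _ fun b _ => (hM a b).mul continuous_const)) _ _
    change ∑ a, v a * ∑ b, (∫ τ in t..t + T, M τ a b) * v b
      = ∫ τ in t..t + T, ∑ a, v a * ∑ b, M τ a b * v b
    rw [intervalIntegral.integral_finsetSum fun a _ => i2 a]
    refine Finset.sum_congr rfl fun a _ => ?_
    rw [intervalIntegral.integral_const_mul, intervalIntegral.integral_finsetSum fun b _ => i1 a b]
    simp only [intervalIntegral.integral_mul_const]
  have hquad : α * euclNorm v ^ 2 ≤
      v ⬝ᵥ ((Matrix.of fun a b => ∫ τ in t..(t + T), M τ a b) *ᵥ v) := by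
    have h := hPE.dotProduct_mulVec_nonneg v
    rw [star_trivial, Matrix.sub_mulVec, dotProduct_sub, Matrix.smul_mulVec, Matrix.one_mulVec,
      dotProduct_smul, smul_eq_mul] at h
    rw [euclNorm_sq]
    have e : v ⬝ᵥ v = ∑ i, v i ^ 2 := Finset.sum_congr rfl fun i _ => (sq _).symm
    rw [e] at h
    linarith
  have hmono : ∫ τ in t..t + T, v ⬝ᵥ (M τ *ᵥ v) ≤
      euclNorm v * ∫ τ in t..t + T, euclNorm (M τ *ᵥ v) := by
    rw [← intervalIntegral.integral_const_mul]
    refine intervalIntegral.integral_mono_on hle ?_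
      ((continuous_const.mul hcont).intervalIntegrable _ _)
      fun τ _ => dotProduct_le_euclNorm_mul _ _
    exact Continuous.intervalIntegrable (continuous_finsetSum _ fun a _ => continuous_const.mul
      (continuous_finsetSum _ fun b _ => (hM a b).mul continuous_const)) _ _
  rcases (euclNorm_nonneg v).eq_or_lt with h0 | hpos
  · rw [← h0, mul_zero]
    exact intervalIntegral.integral_nonneg hle fun _ _ => euclNorm_nonneg _
  · nlinarith

lemma euclNorm_sub_rev_triangle (v w : n → ℝ) : euclNorm w - euclNorm (v - w) ≤ euclNorm v := by
  simp only [euclNorm_eq_norm_toLp, WithLp.toLp_sub]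
  have := norm_sub_norm_le (WithLp.toLp 2 w) (WithLp.toLp 2 v)
  rw [norm_sub_rev] at this
  linarith

/-- Excitation is inherited by a regressor that is eventually close to an exciting one. -/
lemma excitation_of_eventually_close {H M : ℝ → Matrix n n ℝ} {a r T t₁ : ℝ} (hT : 0 ≤ T)
    (ht₁ : 0 ≤ t₁) (hH : ∀ a b, ContinuousOn (fun t => H t a b) (Ici 0))
    (hM : ∀ a b, ContinuousOn (fun t => M t a b) (Ici 0))
    (hPE : ∀ t, 0 ≤ t → ∀ v, a * euclNorm v ≤ ∫ τ in t..t + T, euclNorm (M τ *ᵥ v))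
    (hclose : ∀ t, t₁ ≤ t → ∀ v, euclNorm ((H t - M t) *ᵥ v) ≤ r * euclNorm v)
    {t : ℝ} (ht : 0 ≤ t) (v : n → ℝ) :
    (a - r * T) * euclNorm v ≤ ∫ τ in t..t + (t₁ + T), euclNorm (H τ *ᵥ v) := by
  have hHc := continuousOn_euclNorm_mulVec hH v
  have hMc := continuousOn_euclNorm_mulVec hM v
  have hsub : Icc (t + t₁) (t + t₁ + T) ⊆ Ici 0 := fun s hs => (add_nonneg ht ht₁).trans hs.1
  have hle : t + t₁ ≤ t + t₁ + T := by linarith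
  have iM : IntervalIntegrable (fun τ => euclNorm (M τ *ᵥ v)) volume (t + t₁) (t + t₁ + T) :=
    (hMc.mono hsub).intervalIntegrable_of_Icc hle
  have h1 := hPE (t + t₁) (by linarith) v
  have h2 : ∫ τ in t + t₁..t + t₁ + T, (euclNorm (M τ *ᵥ v) - r * euclNorm v) ≤
      ∫ τ in t + t₁..t + t₁ + T, euclNorm (H τ *ᵥ v) := by
    refine intervalIntegral.integral_mono_on hle (iM.sub (by simp))
      ((hHc.mono hsub).intervalIntegrable_of_Icc hle) fun τ hτ => ?_
    have h3 := hclose τ (by linarith [hτ.1]) v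
    rw [Matrix.sub_mulVec] at h3
    linarith [euclNorm_sub_rev_triangle (H τ *ᵥ v) (M τ *ᵥ v)]
  rw [intervalIntegral.integral_sub iM (by simp), intervalIntegral.integral_const,
    add_sub_cancel_left, smul_eq_mul] at h2
  have h4 : ∫ τ in t + t₁..t + t₁ + T, euclNorm (H τ *ᵥ v) ≤
      ∫ τ in t..t + (t₁ + T), euclNorm (H τ *ᵥ v) := by
    refine intervalIntegral.integral_mono_interval (by linarith) hle (by linarith)
      (Eventually.of_forall fun _ => euclNorm_nonneg _) ?_
    exact (hHc.mono fun s hs => ht.trans hs.1).intervalIntegrable_of_Icc (by linarith)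
  linarith

/-- Exponential stability of the error of the gradient estimator with positive definite gain. -/
lemma gradient_estimator_exp_decay [DecidableEq n] {H : ℝ → Matrix n n ℝ} {Γ : Matrix n n ℝ}
    (hΓ : Γ.PosDef) {z : ℝ → n → ℝ} {a b T : ℝ} (ha : 0 < a) (hb0 : 0 ≤ b) (hT : 0 < T)
    (hH : ∀ a b, ContinuousOn (fun t => H t a b) (Ici 0))
    (hb : ∀ t, 0 ≤ t → ∀ v, euclNorm (H t *ᵥ v) ≤ b * euclNorm v)
    (hPE : ∀ t, 0 ≤ t → ∀ v, a * euclNorm v ≤ ∫ τ in t..t + T, euclNorm (H τ *ᵥ v))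
    (hz : ∀ t, 0 ≤ t →
      HasDerivWithinAt z (-(Γ *ᵥ ((H t)ᵀ *ᵥ (H t *ᵥ z t)))) (Ici 0) t) :
    ∃ κ > (0 : ℝ), ∃ μ > (0 : ℝ), ∀ t₀ t : ℝ, 0 ≤ t₀ → t₀ ≤ t →
      euclNorm (z t) ≤ κ * Real.exp (-μ * (t - t₀)) * euclNorm (z t₀) := by
  obtain ⟨R, S, hRS, hSR, rfl⟩ := hΓ.exists_eq_mul_transpose
  simp only [euclNorm_eq_norm_toLp] at hb hPE ⊢
  refine preconditioned_gradient_flow_exp_decay (A := fun t => toEuclideanCLM (𝕜 := ℝ) (H t))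
    (R := toEuclideanCLM (𝕜 := ℝ) R) (S := toEuclideanCLM (𝕜 := ℝ) S)
    (by rw [← map_mul, hRS, map_one]) (by rw [← map_mul, hSR, map_one]) ha hT
    (continuousOn_toEuclideanCLM hH)
    (fun t ht => ContinuousLinearMap.opNorm_le_bound _ hb0 fun v => hb t ht v.ofLp)
    (fun t ht v => hPE t ht v.ofLp) fun t ht => ?_
  have := (PiLp.continuousLinearEquiv 2 ℝ (fun _ : n => ℝ)).symm.hasFDerivAt.comp_hasDerivWithinAt
    t (hz t ht)
  refine this.congr_deriv ?_
  simp only [← ContinuousLinearMap.star_eq_adjoint, ← map_star]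
  rw [← Matrix.mulVec_mulVec]
  rfl

end Estimator

lemma exists_forall_exp_mul_add_le {μ B c r : ℝ} (hμ : 0 < μ) (hcr : c < r) :
    ∃ t₁ : ℝ, 0 ≤ t₁ ∧ ∀ t, t₁ ≤ t → Real.exp (-μ * t) * B + c ≤ r := by
  have h : Filter.Tendsto (fun t : ℝ => Real.exp (-μ * t) * B + c) Filter.atTop
      (nhds (0 * B + c)) := by
    refine ((Real.tendsto_exp_atBot.comp ?_).mul_const B).add_const c
    exact Filter.tendsto_id.const_mul_atTop_of_neg (by linarith)
  rw [zero_mul, zero_add] at h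
  obtain ⟨t₁, ht₁⟩ := Filter.eventually_atTop.1 (h.eventually_le_const hcr)
  exact ⟨max t₁ 0, le_max_right _ _, fun t ht => ht₁ t ((le_max_left _ _).trans ht)⟩

lemma hasDerivWithinAt_mulVec_apply {m n : Type*} [Fintype n] {M : ℝ → Matrix m n ℝ} {a : m}
    {M' : n → ℝ} {s : Set ℝ} {t : ℝ}
    (h : ∀ b, HasDerivWithinAt (fun r => M r a b) (M' b) s t) (v : n → ℝ) :
    HasDerivWithinAt (fun r => (M r *ᵥ v) a) (∑ b, M' b * v b) s t := by
  change HasDerivWithinAt (fun r => ∑ b, M r a b * v b) _ _ _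
  exact HasDerivWithinAt.fun_sum fun b _ => (h b).mul_const (v b)

lemma hasDerivAt_transpose_mul_self_apply {m n : Type*} [Fintype m] {C C' : ℝ → Matrix m n ℝ}
    {t : ℝ} (h : ∀ a b, HasDerivAt (fun s => C s a b) (C' t a b) t) (a b : n) :
    HasDerivAt (fun s => ((C s)ᵀ * C s) a b) (((C' t)ᵀ * C t + (C t)ᵀ * C' t) a b) t := by
  simp only [Matrix.mul_apply, Matrix.add_apply, Matrix.transpose_apply,
    ← Finset.sum_add_distrib]
  exact HasDerivAt.fun_sum fun c _ => (h c a).mul (h c b)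

/-- (Main theorem: hierarchical distributed gradient estimation.)
Under cooperative persistency of excitation of the stacked regressor, boundedness
of the averaged regressor and of the stacked deviation of the derivatives, and the
consensus-gain condition `k > 2 n N² β γ T² / (λ_G α²)`, the DAC + local gradient
estimator scheme with zero initial consensus states yields globally uniformly
exponentially stable estimation errors `θ̂ᵢ(t) − θ` for every agent. -/
theorem hierarchical_distributed_estimator_GUES
    (N n : ℕ) (G : SimpleGraph (Fin N)) [DecidableRel G.Adj]
    (hconn : G.Connected)
    (lamG : ℝ) (hlamG : 0 < lamG)
    (hLap : ∀ v : Fin N → ℝ, (∑ i, v i) = 0 →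
      lamG * (∑ i, v i ^ 2) ≤ v ⬝ᵥ ((G.lapMatrix ℝ).mulVec v))
    (θ : Fin n → ℝ) (α T β γ k : ℝ) (hα : 0 < α) (hT : 0 < T)
    (p : Fin N → ℕ)
    (C : ∀ i : Fin N, ℝ → Matrix (Fin (p i)) (Fin n) ℝ)
    (Cd : ∀ i : Fin N, ℝ → Matrix (Fin (p i)) (Fin n) ℝ)
    (hderiv : ∀ i a b t, HasDerivAt (fun s => C i s a b) (Cd i t a b) t)
    (hCdcont : ∀ i a b, Continuous fun t => Cd i t a b)
    (C' : Fin N → ℝ → Matrix (Fin n) (Fin n) ℝ)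
    (hC' : ∀ i t, C' i t = (C i t)ᵀ * C i t)
    (C'd : Fin N → ℝ → Matrix (Fin n) (Fin n) ℝ)
    (hC'd : ∀ i t, C'd i t = (Cd i t)ᵀ * C i t + (C i t)ᵀ * Cd i t)
    (Cbar : ℝ → Matrix (Fin n) (Fin n) ℝ)
    (hCbar : ∀ t, Cbar t = (N : ℝ)⁻¹ • ∑ i, C' i t)
    -- (i) cooperative persistency of excitation of the stacked regressor
    (hPE : ∀ t ≥ (0 : ℝ), Matrix.PosSemidef
      ((Matrix.of fun a b => ∫ τ in t..(t + T), (∑ i, C' i τ) a b) -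
        α • (1 : Matrix (Fin n) (Fin n) ℝ)))
    -- (ii) bounds on the averaged regressor and the stacked deviation matrix
    (hβ : ∀ t ≥ (0 : ℝ), ∀ v : Fin n → ℝ,
      euclNorm ((Cbar t).mulVec v) ≤ β * euclNorm v)
    (D : ℝ → Matrix (Fin N × Fin n) (Fin n) ℝ)
    (hD : ∀ t i a b, D t (i, a) b = C'd i t a b - (N : ℝ)⁻¹ * ∑ j, C'd j t a b)
    (hγ : ∀ t ≥ (0 : ℝ), ∀ v : Fin n → ℝ,
      euclNorm ((D t).mulVec v) ≤ γ * euclNorm v)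
    -- (iii) consensus-gain condition
    (hk : k > 2 * n * N ^ 2 * β * γ * T ^ 2 / (lamG * α ^ 2))
    -- the distributed algorithm
    (X : Fin N → ℝ → Matrix (Fin n) (Fin n) ℝ)
    (x : Fin N → ℝ → (Fin n → ℝ))
    (θhat : Fin N → ℝ → (Fin n → ℝ))
    (Γ : Fin N → Matrix (Fin n) (Fin n) ℝ) (hΓ : ∀ i, (Γ i).PosDef)
    (Chat : Fin N → ℝ → Matrix (Fin n) (Fin n) ℝ)
    (hChat : ∀ i t, Chat i t = C' i t - X i t)
    (yhat : Fin N → ℝ → (Fin n → ℝ))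
    (hyhat : ∀ i t, yhat i t = (C' i t).mulVec θ - x i t)
    (hX : ∀ i, ∀ t ≥ (0 : ℝ), ∀ a b,
      HasDerivWithinAt (fun s => X i s a b)
        (k * ∑ j ∈ G.neighborFinset i, (Chat i t a b - Chat j t a b))
        (Set.Ici 0) t)
    (hx : ∀ i, ∀ t ≥ (0 : ℝ),
      HasDerivWithinAt (x i)
        (k • ∑ j ∈ G.neighborFinset i, (yhat i t - yhat j t))
        (Set.Ici 0) t)
    (hθ : ∀ i, ∀ t ≥ (0 : ℝ),
      HasDerivWithinAt (θhat i)
        ((Γ i).mulVec ((Chat i t)ᵀ.mulVec (yhat i t - (Chat i t).mulVec (θhat i t))))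
        (Set.Ici 0) t)
    (hX0 : ∀ i, X i 0 = 0) (hx0 : ∀ i, x i 0 = 0) :
    ∃ κ > (0 : ℝ), ∃ lam > (0 : ℝ),
      ∀ i : Fin N, ∀ t₀ t : ℝ, 0 ≤ t₀ → t₀ ≤ t →
        euclNorm (θhat i t - θ) ≤
          κ * Real.exp (-lam * (t - t₀)) * euclNorm (θhat i t₀ - θ) := by
  rcases Nat.eq_zero_or_pos n with rfl | hn
  · exact ⟨1, one_pos, 1, one_pos, fun i t₀ t _ _ => by simp [euclNorm]⟩
  suffices h : ∀ i, ∃ κ > (0 : ℝ), ∃ lam > (0 : ℝ), ∀ t₀ t : ℝ, 0 ≤ t₀ → t₀ ≤ t →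
      euclNorm (θhat i t - θ) ≤ κ * Real.exp (-lam * (t - t₀)) * euclNorm (θhat i t₀ - θ) by
    choose κ hκ μ hμ h using h
    obtain ⟨K, hK⟩ := (Set.finite_range κ).bddAbove
    obtain ⟨L, hL⟩ := (Set.finite_range fun i => (μ i)⁻¹).bddAbove
    refine ⟨max K 1, by positivity, (max L 1)⁻¹, by positivity, fun i t₀ t ht₀ ht => ?_⟩
    refine (h i t₀ t ht₀ ht).trans ?_
    have hκK : κ i ≤ max K 1 := (hK ⟨i, rfl⟩).trans (le_max_left _ _)
    have hμL : (max L 1)⁻¹ ≤ μ i :=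
      inv_le_of_inv_le₀ (hμ i) ((hL ⟨i, rfl⟩).trans (le_max_left _ _))
    have := euclNorm_nonneg (θhat i t₀ - θ)
    gcongr
  -- positivity of the constants
  obtain ⟨i₀⟩ := hconn.nonempty
  have hN : 0 < N := i₀.pos
  have hNR : (0 : ℝ) < N := by exact_mod_cast hN
  have hnR : (1 : ℝ) ≤ n := by exact_mod_cast hn
  have hNR1 : (1 : ℝ) ≤ N := by exact_mod_cast hN
  have hC'deriv : ∀ i a b t, HasDerivAt (fun s => C' i s a b) (C'd i t a b) t := by
    intro i a b t
    simp only [hC', hC'd]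
    exact hasDerivAt_transpose_mul_self_apply (fun a b => hderiv i a b t) a b
  have hC'cont : ∀ i a b, Continuous fun t => C' i t a b := fun i a b =>
    continuous_iff_continuousAt.2 fun t => (hC'deriv i a b t).continuousAt
  have hCbarcont : ∀ a b, Continuous fun t => Cbar t a b := by
    intro a b
    simp only [hCbar, Matrix.smul_apply, Matrix.sum_apply, smul_eq_mul]
    exact continuous_const.mul (continuous_finsetSum _ fun i _ => hC'cont i a b)
  have hPEbar : ∀ t, 0 ≤ t → ∀ v, α / N * euclNorm v ≤
      ∫ τ in t..t + T, euclNorm (Cbar τ *ᵥ v) := by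
    intro t ht v
    have h := mul_euclNorm_le_integral_of_posSemidef (M := fun τ => ∑ i, C' i τ) hT.le
      (fun a b => by
        simp only [Matrix.sum_apply]
        exact continuous_finsetSum _ fun i _ => hC'cont i a b) (hPE t ht) v
    have e : ∀ τ, euclNorm (Cbar τ *ᵥ v) = (N : ℝ)⁻¹ * euclNorm ((∑ i, C' i τ) *ᵥ v) := by
      intro τ
      rw [hCbar, Matrix.smul_mulVec, euclNorm_eq_norm_toLp, euclNorm_eq_norm_toLp,
        WithLp.toLp_smul, norm_smul, Real.norm_of_nonneg (by positivity)]
    simp only [e]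
    rw [intervalIntegral.integral_const_mul, div_mul_eq_mul_div, div_eq_inv_mul]
    gcongr
  obtain ⟨v₀, hv₀⟩ : ∃ v : Fin n → ℝ, 0 < euclNorm v :=
    ⟨fun _ => 1, Real.sqrt_pos.2 (by simpa using hn)⟩
  have hγ0 : 0 ≤ γ := nonneg_of_mul_nonneg_left ((euclNorm_nonneg _).trans (hγ 0 le_rfl v₀)) hv₀
  have hαβ : α ≤ N * T * β := by
    have h1 := hPEbar 0 le_rfl v₀
    have h2 : ∫ τ in (0 : ℝ)..0 + T, euclNorm (Cbar τ *ᵥ v₀) ≤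
        ∫ _ in (0 : ℝ)..0 + T, β * euclNorm v₀ := by
      refine intervalIntegral.integral_mono_on (by linarith) ?_ (by simp) fun τ hτ =>
        hβ τ hτ.1 v₀
      exact (continuousOn_univ.1 (continuousOn_euclNorm_mulVec
        (fun a b => (hCbarcont a b).continuousOn) v₀)).intervalIntegrable _ _
    rw [intervalIntegral.integral_const, add_sub_cancel_left, smul_eq_mul, ← mul_assoc] at h2
    have h3 := le_of_mul_le_mul_right (h1.trans h2) hv₀
    rw [div_le_iff₀ hNR] at h3
    linarith
  have hβ0 : 0 < β := pos_of_mul_pos_right (hα.trans_le hαβ) (by positivity)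
  have hk0 : 0 < k := lt_of_le_of_lt (by positivity) hk
  set μ := k * lamG with hμ
  have hμ0 : 0 < μ := by positivity
  have hgain : γ / μ < α / (N * T) := by
    rw [gt_iff_lt, div_lt_iff₀ (by positivity)] at hk
    rw [div_lt_div_iff₀ hμ0 (by positivity)]
    have h1 : γ * (N * T) * α ≤ γ * (N * T) * (N * T * β) := by gcongr
    have h2 : γ * (N * T) * (N * T * β) ≤ 2 * n * N ^ 2 * β * γ * T ^ 2 := by
      have : 0 ≤ (2 * (n : ℝ) - 1) * (N ^ 2 * β * γ * T ^ 2) :=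
        mul_nonneg (by linarith) (by positivity)
      nlinarith
    have h3 : γ * (N * T) * α < α * μ * α := by rw [hμ]; nlinarith
    exact lt_of_mul_lt_mul_right h3 hα.le
  -- the consensus on the measurements is consistent with the one on the regressors
  have hcons : ∀ i t, 0 ≤ t → yhat i t = Chat i t *ᵥ θ := by
    set w : Fin N → Fin n → ℝ → ℝ := fun i a t => (X i t *ᵥ θ) a - x i t a with hw
    have hweq : ∀ i a t, w i a t = yhat i t a - (Chat i t *ᵥ θ) a := by
      intro i a t
      rw [hyhat, hChat, Matrix.sub_mulVec]
      simp only [hw, Pi.sub_apply]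
      ring
    have hwd : ∀ i a t, 0 ≤ t → HasDerivWithinAt (w i a)
        (k * ∑ j ∈ G.neighborFinset i, (-w i a t - -w j a t)) (Set.Ici 0) t := by
      intro i a t ht
      have h1 : HasDerivWithinAt (fun s => (X i s *ᵥ θ) a)
          (∑ b, k * (∑ j ∈ G.neighborFinset i, (Chat i t a b - Chat j t a b)) * θ b)
          (Set.Ici 0) t :=
        hasDerivWithinAt_mulVec_apply (hX i t ht a) θ
      refine (h1.sub (hasDerivWithinAt_pi.1 (hx i t ht) a)).congr_deriv ?_
      simp only [hweq, Pi.smul_apply, Finset.sum_apply, Pi.sub_apply, smul_eq_mul, mulVec,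
        dotProduct, Finset.mul_sum, Finset.sum_mul]
      rw [Finset.sum_comm, ← Finset.sum_sub_distrib]
      refine Finset.sum_congr rfl fun j _ => ?_
      simp only [mul_sub, sub_mul, Finset.sum_sub_distrib, mul_assoc, ← Finset.mul_sum]
      ring
    have hw0 : ∀ i a, w i a 0 = 0 := fun i a => by simp [hw, hX0, hx0]
    intro i t ht
    have h := consensus_disagreement_le G (d := fun _ _ _ => 0) hlamG hk0 le_rfl hLap
      (fun i a t ht => (hwd i a t ht).congr_deriv (by
        rw [zero_sub, ← mul_neg, ← Finset.sum_neg_distrib]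
        congr 1
        exact Finset.sum_congr rfl fun j _ => by ring))
      (fun a t ht => by
        rw [sum_eq_sum_zero_of_diffusive G (fun i t ht => hwd i a t ht) ht]
        simp [hw0]) (by simp) ht
    simp only [hw0] at h
    have h0 : ∑ i, ∑ a, w i a t ^ 2 = 0 := le_antisymm (by simpa using h) (by positivity)
    have h1 := (Finset.sum_eq_zero_iff_of_nonneg fun i _ => by positivity).1 h0 i
      (Finset.mem_univ _)
    ext a
    have h2 := (Finset.sum_eq_zero_iff_of_nonneg fun a _ => by positivity).1 h1 a
      (Finset.mem_univ _)
    have h3 := hweq i a t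
    rw [pow_eq_zero_iff two_ne_zero] at h2
    linarith
  -- disagreement of the local regressors with the average
  have hsumX : ∀ a b t, 0 ≤ t → ∑ i, X i t a b = 0 := by
    intro a b t ht
    rw [sum_eq_sum_zero_of_diffusive G (y := fun i t => X i t a b)
      (g := fun i t => Chat i t a b) (fun i t ht => hX i t ht a b) ht]
    simp [hX0]
  have hsumE : ∀ a b t, 0 ≤ t → ∑ i, (Chat i t - Cbar t) a b = 0 := by
    intro a b t ht
    simp only [hChat, hCbar, Matrix.sub_apply, Matrix.smul_apply, Matrix.sum_apply, smul_eq_mul,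
      Finset.sum_sub_distrib, hsumX a b t ht, Finset.sum_const, Finset.card_univ,
      Fintype.card_fin, nsmul_eq_mul]
    field_simp
    ring
  have hEd : ∀ i a b t, 0 ≤ t → HasDerivWithinAt (fun s => (Chat i s - Cbar s) a b)
      (D t (i, a) b - k * ∑ j ∈ G.neighborFinset i,
        ((Chat i t - Cbar t) a b - (Chat j t - Cbar t) a b)) (Set.Ici 0) t := by
    intro i a b t ht
    have h1 := ((hC'deriv i a b t).hasDerivWithinAt (s := Set.Ici 0)).sub (hX i t ht a b)
    have h2 := ((HasDerivAt.fun_sum (u := Finset.univ)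
      fun j _ => hC'deriv j a b t).const_mul (N : ℝ)⁻¹).hasDerivWithinAt (s := Set.Ici 0)
    have h3 : (fun s => (Chat i s - Cbar s) a b) =
        fun s => C' i s a b - X i s a b - (N : ℝ)⁻¹ * ∑ j, C' j s a b := by
      funext s
      simp only [hChat, hCbar, Matrix.sub_apply, Matrix.smul_apply, Matrix.sum_apply, smul_eq_mul]
    rw [h3]
    refine (h1.sub h2).congr_deriv ?_
    simp only [hD, Matrix.sub_apply, sub_sub_sub_cancel_right]
    ring
  set B := ∑ i, ∑ a, ∑ b, (Chat i 0 - Cbar 0) a b ^ 2 with hB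
  have hB0 : 0 ≤ B := by positivity
  have hdis : ∀ i t, 0 ≤ t → ∀ v, euclNorm ((Chat i t - Cbar t) *ᵥ v) ^ 2 ≤
      (Real.exp (-μ * t) * B + γ ^ 2 / μ ^ 2) * euclNorm v ^ 2 := by
    intro i t ht v
    have h := consensus_disagreement_le G (p := (γ * euclNorm v) ^ 2)
      (w := fun i a t => ((Chat i t - Cbar t) *ᵥ v) a) (d := fun i a t => (D t *ᵥ v) (i, a))
      hlamG hk0 (by positivity) hLap
      (fun i a t ht => (hasDerivWithinAt_mulVec_apply
        (fun b => hEd i a b t ht) v).congr_deriv (by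
          simp only [mulVec, dotProduct, sub_mul, Finset.sum_sub_distrib, Finset.mul_sum,
            Finset.sum_mul, mul_sub, mul_assoc]
          rw [Finset.sum_comm (s := Finset.univ), Finset.sum_comm (s := Finset.univ)]))
      (fun a t ht => by
        simp only [mulVec, dotProduct]
        rw [Finset.sum_comm]
        simp only [← Finset.sum_mul, hsumE a _ t ht, zero_mul, Finset.sum_const_zero])
      (fun t ht => by
        rw [← Fintype.sum_prod_type' (f := fun i a => (D t *ᵥ v) (i, a) ^ 2), ← euclNorm_sq]
        exact pow_le_pow_left₀ (euclNorm_nonneg _) (hγ t ht v) 2) ht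
    have h0 : ∑ i, ∑ a, ((Chat i 0 - Cbar 0) *ᵥ v) a ^ 2 ≤ B * euclNorm v ^ 2 := by
      rw [hB, Finset.sum_mul]
      exact Finset.sum_le_sum fun i _ => sum_mulVec_sq_le _ _
    have h1 : euclNorm ((Chat i t - Cbar t) *ᵥ v) ^ 2 ≤
        ∑ i, ∑ a, ((Chat i t - Cbar t) *ᵥ v) a ^ 2 := by
      rw [euclNorm_sq]
      exact Finset.single_le_sum (f := fun i => ∑ a, ((Chat i t - Cbar t) *ᵥ v) a ^ 2)
        (fun i _ => by positivity) (Finset.mem_univ i)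
    have h2 := mul_le_mul_of_nonneg_left h0 (Real.exp_pos (-μ * t)).le
    refine (h1.trans h).trans ?_
    rw [← hμ, mul_pow, add_mul, div_mul_eq_mul_div]
    linarith
  -- excitation and boundedness of the local regressors
  obtain ⟨r, hγr, hrα⟩ := exists_between hgain
  have hr0 : 0 < r := (div_nonneg hγ0 hμ0.le).trans_lt hγr
  obtain ⟨t₁, ht₁, hsmall⟩ := exists_forall_exp_mul_add_le (B := B) hμ0
    (show γ ^ 2 / μ ^ 2 < r ^ 2 by
      rw [← div_pow]; exact pow_lt_pow_left₀ hγr (div_nonneg hγ0 hμ0.le) two_ne_zero)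
  have hclose : ∀ i t, t₁ ≤ t → ∀ v, euclNorm ((Chat i t - Cbar t) *ᵥ v) ≤ r * euclNorm v := by
    intro i t ht v
    have := euclNorm_nonneg v
    refine (pow_le_pow_iff_left₀ (euclNorm_nonneg _) (by positivity) two_ne_zero).1 ?_
    rw [mul_pow]
    exact (hdis i t (ht₁.trans ht) v).trans (by gcongr; exact hsmall t ht)
  have hbdd : ∀ i t, 0 ≤ t → ∀ v, euclNorm (Chat i t *ᵥ v) ≤
      (β + √(B + γ ^ 2 / μ ^ 2)) * euclNorm v := by
    intro i t ht v
    have hv := euclNorm_nonneg v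
    have h1 : euclNorm ((Chat i t - Cbar t) *ᵥ v) ≤ √(B + γ ^ 2 / μ ^ 2) * euclNorm v := by
      refine (pow_le_pow_iff_left₀ (euclNorm_nonneg _) (by positivity) two_ne_zero).1 ?_
      rw [mul_pow, Real.sq_sqrt (by positivity)]
      refine (hdis i t ht v).trans ?_
      gcongr
      refine mul_le_of_le_one_left hB0 (Real.exp_le_one_iff.2 ?_)
      nlinarith
    have h2 := euclNorm_sub_rev_triangle (Cbar t *ᵥ v) (Chat i t *ᵥ v)
    have h3 : euclNorm (Chat i t *ᵥ v - Cbar t *ᵥ v) =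
        euclNorm (Cbar t *ᵥ v - Chat i t *ᵥ v) := by
      simp only [euclNorm_eq_norm_toLp, WithLp.toLp_sub]
      exact norm_sub_rev _ _
    rw [Matrix.sub_mulVec, h3] at h1
    linarith [hβ t ht v]
  intro i
  have hChatcont : ∀ a b, ContinuousOn (fun t => Chat i t a b) (Set.Ici 0) := by
    intro a b
    simp only [hChat, Matrix.sub_apply]
    exact (hC'cont i a b).continuousOn.sub fun t ht => (hX i t ht a b).continuousWithinAt
  refine gradient_estimator_exp_decay (H := Chat i) (z := fun t => θhat i t - θ) (hΓ i)
    (a := α / N - r * T) (b := β + √(B + γ ^ 2 / μ ^ 2)) (T := t₁ + T) ?_ (by positivity)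
    (by positivity) hChatcont (hbdd i)
    (fun t ht v => excitation_of_eventually_close hT.le ht₁ hChatcont
      (fun a b => (hCbarcont a b).continuousOn) hPEbar (hclose i) ht v) fun t ht => ?_
  · rw [lt_div_iff₀ (by positivity)] at hrα
    rw [sub_pos, lt_div_iff₀ hNR]
    linarith
  · refine ((hθ i t ht).sub_const θ).congr_deriv ?_
    rw [hcons i t ht, ← Matrix.mulVec_sub, ← neg_sub (θhat i t) θ]
    simp only [Matrix.mulVec_neg]
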